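/- Let β ∈ (1,2] and let B_β : [0,1] → [0,1] be given by B_β(x) = βx for x ∈ [0,1/2] and B_β(x) = 1 − β(1−x) for x ∈ (1/2,1]. For every ε > 0 there exist a nonempty compact set 𝓑 ⊆ [0,1] with B_β(𝓑) ⊆ 𝓑 and a finite collection 𝓓 of closed intervals such that: (1) every interval of 𝓓 is contained in [0,1/2] or in [1/2,1]; (2) distinct intervals of 𝓓 have disjoint interiors; (3) 𝓑 ⊆ ⋃_{𝔍∈𝓓} 𝔍; (4) for any 𝔍₁,𝔍₂ ∈ 𝓓, either B_β(𝔍₁∩𝓑) ∩ (𝔍₂∩𝓑) = ∅ or 𝔍₂∩𝓑 ⊆ B_β(𝔍₁∩𝓑); (5) some interval of 𝓓 contains 0 and some interval of 𝓓 contains 1; and (6) the topological entropy of the restriction of B_β to 𝓑 is greater than log β − ε. -/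

import Mathlib

/-- The base map `B_β : [0,1] → [0,1]`, `B_β(x) = βx` on `[0,1/2]` and
`B_β(x) = 1 - β(1-x)` on `(1/2,1]`. -/
noncomputable def Bmap (β : ℝ) (x : ℝ) : ℝ := if x ≤ 1 / 2 then β * x else 1 - β * (1 - x)

open Set Filter

section BaseMap

variable {β : ℝ}

lemma Bmap_of_le {x : ℝ} (h : x ≤ 1 / 2) : Bmap β x = β * x := if_pos h

lemma Bmap_of_lt {x : ℝ} (h : 1 / 2 < x) : Bmap β x = 1 - β * (1 - x) := if_neg h.not_ge

lemma Bmap_zero : Bmap β 0 = 0 := by rw [Bmap_of_le (by norm_num), mul_zero]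

lemma Bmap_one : Bmap β 1 = 1 := by rw [Bmap_of_lt (by norm_num)]; ring

lemma mapsTo_Bmap (h₁ : 1 < β) (h₂ : β ≤ 2) : MapsTo (Bmap β) (Icc 0 1) (Icc 0 1) := by
  rintro x ⟨hx₀, hx₁⟩
  rcases le_or_gt x (1 / 2) with h | h
  · rw [Bmap_of_le h]; constructor <;> nlinarith
  · rw [Bmap_of_lt h]; constructor <;> nlinarith

lemma iterate_Bmap_mem (h₁ : 1 < β) (h₂ : β ≤ 2) {x : ℝ} (hx : x ∈ Icc (0 : ℝ) 1) (n : ℕ) :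
    (Bmap β)^[n] x ∈ Icc (0 : ℝ) 1 := (mapsTo_Bmap h₁ h₂).iterate n hx

lemma continuousOn_Bmap {c d : ℝ} (hc : c < 1 / 2) (hd : 1 / 2 < d) :
    ContinuousOn (Bmap β) (Ioo c d)ᶜ := by
  have h : (Ioo c d)ᶜ = Iic c ∪ Ici d := by
    ext x; simp only [mem_compl_iff, mem_Ioo, not_and, not_lt, mem_union, mem_Iic, mem_Ici]
    grind
  rw [h]
  refine ContinuousOn.union_of_isClosed ?_ ?_ isClosed_Iic isClosed_Ici
  · refine ContinuousOn.congr (f := fun x => β * x) (by fun_prop) fun x hx => ?_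
    exact Bmap_of_le (le_trans hx hc.le)
  · refine ContinuousOn.congr (f := fun x => 1 - β * (1 - x)) (by fun_prop) fun x hx => ?_
    exact Bmap_of_lt (lt_of_lt_of_le hd hx)

/-- An iterate of the base map is affine on an interval whose earlier images miss `1/2`. -/
lemma iterate_Bmap_sub (hβ : 0 < β) {u v : ℝ} {m : ℕ}
    (h : ∀ k < m, ∀ z ∈ Ioo u v, (Bmap β)^[k] z ≠ 1 / 2) {x y : ℝ} (hx : x ∈ Ioo u v)
    (hy : y ∈ Ioo u v) : (Bmap β)^[m] y - (Bmap β)^[m] x = β ^ m * (y - x) := by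
  induction m generalizing x y with
  | zero => simp
  | succ m ih =>
    have ih' := fun {x y : ℝ} => @ih (fun k hk => h k (hk.trans m.lt_succ_self)) x y
    have hpow : 0 < β ^ m := by positivity
    have key : ∀ {x y : ℝ}, x ∈ Ioo u v → y ∈ Ioo u v → (Bmap β)^[m] x < 1 / 2 →
        ¬ 1 / 2 < (Bmap β)^[m] y := by
      intro x y hx hy hx' hy'
      have e := ih' hx hy
      set t := (1 / 2 - (Bmap β)^[m] x) / ((Bmap β)^[m] y - (Bmap β)^[m] x) with ht
      have hden : 0 < (Bmap β)^[m] y - (Bmap β)^[m] x := by linarith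
      have ht₀ : 0 < t := div_pos (by linarith) hden
      have ht₁ : t < 1 := (div_lt_one hden).2 (by linarith)
      have hz : x + t * (y - x) ∈ Ioo u v := by
        obtain ⟨_, _⟩ := hx
        obtain ⟨_, _⟩ := hy
        constructor <;> nlinarith
      have e₂ := ih' hx hz
      have e₃ : t * ((Bmap β)^[m] y - (Bmap β)^[m] x) = 1 / 2 - (Bmap β)^[m] x :=
        div_mul_cancel₀ _ hden.ne'
      apply h m m.lt_succ_self _ hz
      rw [e] at e₃
      linear_combination e₂ + e₃
    rw [Function.iterate_succ_apply', Function.iterate_succ_apply', pow_succ]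
    have e := ih' hx hy
    have nx := h m m.lt_succ_self x hx
    have ny := h m m.lt_succ_self y hy
    rcases lt_or_gt_of_ne nx with hx' | hx' <;> rcases lt_or_gt_of_ne ny with hy' | hy'
    · rw [Bmap_of_le hx'.le, Bmap_of_le hy'.le]; linear_combination β * e
    · exact absurd hy' (key hx hy hx')
    · exact absurd hx' (key hy hx hy')
    · rw [Bmap_of_lt hx', Bmap_of_lt hy']; linear_combination β * e

/-- The iterated preimages of `1/2` are dense. -/
lemma exists_iterate_Bmap_eq_half (h₁ : 1 < β) (h₂ : β ≤ 2) {u v : ℝ} (hu : 0 ≤ u) (huv : u < v)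
    (hv : v ≤ 1) : ∃ z ∈ Ioo u v, ∃ n, (Bmap β)^[n] z = 1 / 2 := by
  by_contra! H
  obtain ⟨x, hux, hxv⟩ := exists_between huv
  obtain ⟨y, hxy, hyv⟩ := exists_between hxv
  obtain ⟨n, hn⟩ := pow_unbounded_of_one_lt (1 / (y - x)) h₁
  rw [div_lt_iff₀ (sub_pos.2 hxy)] at hn
  have e := iterate_Bmap_sub (m := n) (by linarith) (fun k _ z hz => H z hz k)
    (⟨hux, hxv⟩ : x ∈ Ioo u v) ⟨hux.trans hxy, hyv⟩
  have hx := iterate_Bmap_mem h₁ h₂ (⟨by linarith, by linarith⟩ : x ∈ Icc (0 : ℝ) 1) n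
  have hy := iterate_Bmap_mem h₁ h₂ (⟨by linarith, by linarith⟩ : y ∈ Icc (0 : ℝ) 1) n
  linarith [hx.1, hy.2]

lemma finite_preimage_Bmap (hβ : 0 < β) {S : Set ℝ} (hS : S.Finite) :
    (Bmap β ⁻¹' S).Finite := by
  refine ((hS.image fun s => s / β).union (hS.image fun s => 1 - (1 - s) / β)).subset ?_
  intro x hx
  rcases le_or_gt x (1 / 2) with h | h
  · left
    refine ⟨_, hx, ?_⟩
    simp only [Bmap_of_le h]; field_simp
  · right
    refine ⟨_, hx, ?_⟩
    simp only [Bmap_of_lt h]; field_simp; ring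

lemma finite_iterate_Bmap_eq_half (hβ : 0 < β) (m : ℕ) :
    {x | ∃ k < m, (Bmap β)^[k] x = 1 / 2}.Finite := by
  have h : ∀ k, {x | (Bmap β)^[k] x = 1 / 2}.Finite := by
    intro k
    induction k with
    | zero => simp
    | succ k ih => exact finite_preimage_Bmap hβ ih
  refine ((finite_lt_nat m).biUnion fun k _ => h k).subset ?_
  rintro x ⟨k, hk, hx⟩
  exact mem_biUnion (show k ∈ {i | i < m} from hk) hx

/-- At a small enough scale, at least one half of every interval is cut by none of the first
`m` iterates. -/
lemma exists_scale (hβ : 0 < β) (m : ℕ) :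
    ∃ δ : ℝ, 0 < δ ∧ δ ≤ 1 ∧ ∀ x, ∃ u, x ≤ u ∧ u + δ / 2 ≤ x + δ ∧
      ∀ k < m, ∀ z ∈ Ioo u (u + δ / 2), (Bmap β)^[k] z ≠ 1 / 2 := by
  set P : Set ℝ := {x | ∃ k < m, (Bmap β)^[k] x = 1 / 2} ∪ {0, 1} with hP
  have hPfin : P.Finite := (finite_iterate_Bmap_eq_half hβ m).union (by simp)
  have h0 : (0 : ℝ) ∈ P := by simp [hP]
  have h1 : (1 : ℝ) ∈ P := by simp [hP]
  have infsep_le : ∀ {x y}, x ∈ P → y ∈ P → x ≠ y → P.infsep ≤ dist x y := fun hx hy hxy =>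
    Set.infsep_le_dist_of_mem hx hy hxy
  have hpos : 0 < P.infsep := hPfin.infsep_pos_iff_nontrivial.2 ⟨0, h0, 1, h1, by norm_num⟩
  have hle : P.infsep ≤ 1 := by
    simpa using infsep_le h0 h1 (by norm_num)
  refine ⟨P.infsep, hpos, hle, fun x => ?_⟩
  by_cases H : ∀ k < m, ∀ z ∈ Ioo x (x + P.infsep / 2), (Bmap β)^[k] z ≠ 1 / 2
  · exact ⟨x, le_rfl, by linarith, H⟩
  · push Not at H
    obtain ⟨k, hk, p, hp, hpk⟩ := H
    refine ⟨x + P.infsep / 2, by linarith, by linarith, fun j hj z hz hzj => ?_⟩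
    have hpz : p ≠ z := by rintro rfl; linarith [hp.2, hz.1]
    have hd := infsep_le (Or.inl ⟨k, hk, hpk⟩) (Or.inl ⟨j, hj, hzj⟩) hpz
    rw [Real.dist_eq, abs_sub_comm, abs_of_pos (by linarith [hp.2, hz.1])] at hd
    linarith [hp.1, hz.2]

end BaseMap

section Survivors

variable {β c d : ℝ}

/-- The points of `[0,1]` whose orbit under the base map never enters the hole `(c,d)`. -/
def survivors (β c d : ℝ) : Set ℝ :=
  {x | x ∈ Icc (0 : ℝ) 1 ∧ ∀ n, (Bmap β)^[n] x ∉ Ioo c d}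

lemma isClosed_setOf_iterate_notMem (hc : c < 1 / 2) (hd : 1 / 2 < d) (n : ℕ) :
    IsClosed {x | ∀ k < n, (Bmap β)^[k] x ∉ Ioo c d} := by
  induction n with
  | zero => simp
  | succ n ih =>
    have h : {x | ∀ k < n + 1, (Bmap β)^[k] x ∉ Ioo c d} =
        (Ioo c d)ᶜ ∩ Bmap β ⁻¹' {x | ∀ k < n, (Bmap β)^[k] x ∉ Ioo c d} := by
      ext x
      simp only [Nat.forall_lt_succ_left', mem_ofPred_eq, mem_inter_iff, mem_compl_iff,
        mem_preimage, Function.iterate_zero, id, Function.iterate_succ_apply]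
    rw [h]
    exact (continuousOn_Bmap hc hd).preimage_isClosed_of_isClosed isOpen_Ioo.isClosed_compl ih

lemma isCompact_survivors (hc : c < 1 / 2) (hd : 1 / 2 < d) : IsCompact (survivors β c d) := by
  have h : survivors β c d =
      Icc 0 1 ∩ ⋂ n : ℕ, {x | ∀ k < n, (Bmap β)^[k] x ∉ Ioo c d} := by
    ext x
    simp only [survivors, mem_ofPred_eq, mem_inter_iff, mem_iInter]
    exact and_congr_right fun _ => ⟨fun h _ k _ => h k, fun h n => h (n + 1) n n.lt_succ_self⟩
  rw [h]
  exact isCompact_Icc.inter_right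
    (isClosed_iInter fun n => isClosed_setOf_iterate_notMem hc hd n)

lemma mem_survivors_of_Bmap_mem {x : ℝ} (hx : x ∈ Icc (0 : ℝ) 1) (hx' : x ∉ Ioo c d)
    (h : Bmap β x ∈ survivors β c d) : x ∈ survivors β c d := by
  refine ⟨hx, fun n => ?_⟩
  cases n with
  | zero => exact hx'
  | succ n => exact h.2 n

lemma mapsTo_survivors (h₁ : 1 < β) (h₂ : β ≤ 2) :
    MapsTo (Bmap β) (survivors β c d) (survivors β c d) :=
  fun _ hx => ⟨mapsTo_Bmap h₁ h₂ hx.1, fun n => hx.2 (n + 1)⟩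

lemma mem_survivors_of_iterate_mem {x : ℝ} {m : ℕ} (hx : x ∈ Icc (0 : ℝ) 1)
    (hx' : ∀ k < m, (Bmap β)^[k] x ∉ Ioo c d)
    (h : (Bmap β)^[m] x ∈ survivors β c d) : x ∈ survivors β c d := by
  refine ⟨hx, fun n => ?_⟩
  rcases lt_or_ge n m with hn | hn
  · exact hx' n hn
  · obtain ⟨j, rfl⟩ := Nat.exists_eq_add_of_le hn
    rw [add_comm, Function.iterate_add_apply]
    exact h.2 j

lemma zero_mem_survivors (hc : 0 ≤ c) : (0 : ℝ) ∈ survivors β c d := by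
  refine ⟨by simp, fun n => ?_⟩
  rw [Function.iterate_fixed Bmap_zero]
  exact fun h => h.1.not_ge hc

end Survivors

section Partition

/-- `e < e'` are consecutive elements of `E`. -/
def IsConsecutive (E : Finset ℝ) (e e' : ℝ) : Prop :=
  e ∈ E ∧ e' ∈ E ∧ e < e' ∧ ∀ z ∈ E, z ≤ e ∨ e' ≤ z

open Classical in
/-- The closed intervals between consecutive elements of `E`. -/
noncomputable def gapIntervals (E : Finset ℝ) : Finset (Set ℝ) :=
  ((E ×ˢ E).filter fun p => IsConsecutive E p.1 p.2).image fun p => Icc p.1 p.2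

lemma mem_gapIntervals {E : Finset ℝ} {I : Set ℝ} :
    I ∈ gapIntervals E ↔ ∃ e e', IsConsecutive E e e' ∧ I = Icc e e' := by
  classical
  simp only [gapIntervals, Finset.mem_image, Finset.mem_filter, Finset.mem_product, Prod.exists]
  constructor
  · rintro ⟨e, e', ⟨-, h⟩, rfl⟩
    exact ⟨e, e', h, rfl⟩
  · rintro ⟨e, e', h, rfl⟩
    exact ⟨e, e', ⟨⟨h.1, h.2.1⟩, h⟩, rfl⟩

lemma interior_inter_interior_of_mem_gapIntervals {E : Finset ℝ} {I J : Set ℝ}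
    (hI : I ∈ gapIntervals E) (hJ : J ∈ gapIntervals E) (h : I ≠ J) :
    interior I ∩ interior J = ∅ := by
  obtain ⟨e, e', ⟨he, he', -, hE⟩, rfl⟩ := mem_gapIntervals.1 hI
  obtain ⟨f, f', ⟨hf, hf', -, hF⟩, rfl⟩ := mem_gapIntervals.1 hJ
  rw [interior_Icc, interior_Icc, eq_empty_iff_forall_notMem]
  rintro x ⟨⟨h₁, h₂⟩, h₃, h₄⟩
  apply h
  have := hE f hf
  have := hE f' hf'
  have := hF e he
  have := hF e' he'
  congr 1 <;> grind

lemma exists_mem_gapIntervals {E : Finset ℝ} {a b x : ℝ} (ha : a ∈ E) (hb : b ∈ E)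
    (hab : a < b) (hx : x ∈ Icc a b) : ∃ I ∈ gapIntervals E, x ∈ I := by
  rcases hx.2.lt_or_eq with hxb | rfl
  · have hs : (E.filter (· ≤ x)).Nonempty := ⟨a, by simp [ha, hx.1]⟩
    have ht : (E.filter (x < ·)).Nonempty := ⟨b, by simp [hb, hxb]⟩
    have hs' := Finset.mem_filter.1 (Finset.max'_mem _ hs)
    have ht' := Finset.mem_filter.1 (Finset.min'_mem _ ht)
    refine ⟨_, mem_gapIntervals.2 ⟨_, _, ⟨hs'.1, ht'.1, hs'.2.trans_lt ht'.2, fun z hz => ?_⟩,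
      rfl⟩, hs'.2, ht'.2.le⟩
    rcases le_or_gt z x with h | h
    · exact Or.inl (Finset.le_max' _ _ (by simp [hz, h]))
    · exact Or.inr (Finset.min'_le _ _ (by simp [hz, h]))
  · have hs : (E.filter (· < x)).Nonempty := ⟨a, by simp [ha, hab]⟩
    have hs' := Finset.mem_filter.1 (Finset.max'_mem _ hs)
    refine ⟨_, mem_gapIntervals.2 ⟨_, _, ⟨hs'.1, hb, hs'.2, fun z hz => ?_⟩, rfl⟩,
      hs'.2.le, le_rfl⟩
    rcases lt_or_ge z x with h | h
    · exact Or.inl (Finset.le_max' _ _ (by simp [hz, h]))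
    · exact Or.inr h

/-- The Markov property of the survivor set for the intervals cut out by a finite set `E` that
is forward invariant away from `1/2`. -/
lemma gapIntervals_markov {β c d : ℝ} (h₁ : 1 < β) (h₂ : β ≤ 2) (hc : c < 1 / 2)
    (hd : 1 / 2 < d) {E : Finset ℝ} (hcE : c ∈ E) (hdE : d ∈ E) (hhalf : 1 / 2 ∈ E)
    (hE : ∀ e ∈ E, e ∈ Icc (0 : ℝ) 1) (hmap : ∀ e ∈ E, e ≠ 1 / 2 → Bmap β e ∈ E)
    (hsurv : ∀ e ∈ E, e ∈ survivors β c d → e = 0 ∨ e = 1)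
    (hcs : c ∉ survivors β c d) (hds : d ∉ survivors β c d)
    {I J : Set ℝ} (hI : I ∈ gapIntervals E) (hJ : J ∈ gapIntervals E) :
    Bmap β '' (I ∩ survivors β c d) ∩ (J ∩ survivors β c d) = ∅ ∨
      J ∩ survivors β c d ⊆ Bmap β '' (I ∩ survivors β c d) := by
  obtain ⟨e, e', ⟨he, he', hlt, hgap⟩, rfl⟩ := mem_gapIntervals.1 hI
  obtain ⟨f, f', ⟨hf, hf', hflt, hfgap⟩, rfl⟩ := mem_gapIntervals.1 hJ
  have hβ : 0 < β := by linarith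
  have hf₀ := (hE f hf).1
  have hf₁ := (hE f' hf').2
  have he₀ := (hE e he).1
  have he₁ := (hE e' he').2
  have hole : ∀ x ∈ survivors β c d, x ≤ c ∨ d ≤ x := fun x hx => by
    have := hx.2 0
    simp only [Function.iterate_zero, id, mem_Ioo, not_and, not_lt] at this
    exact (le_or_gt x c).imp_right this
  rcases hgap _ hhalf with hside | hside
  · rcases hgap d hdE with hde | hde
    · have he2 : 1 / 2 < e := by linarith
      have hTe := hmap e he he2.ne'
      have hTe' := hmap e' he' (by linarith)
      rw [Bmap_of_lt he2] at hTe
      rw [Bmap_of_lt (by linarith)] at hTe'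
      rcases hfgap _ hTe with hl | hl
      · rcases hfgap _ hTe' with hr | hr
        · left
          rw [eq_empty_iff_forall_notMem]
          rintro y ⟨⟨x, ⟨⟨hx₁, hx₂⟩, -⟩, rfl⟩, ⟨hy₁, hy₂⟩, hy⟩
          rw [Bmap_of_lt (by linarith)] at hy₁ hy₂ hy
          have hyf : 1 - β * (1 - x) = f := by nlinarith
          rw [hyf] at hy
          have : 1 - β * (1 - e') = f := by nlinarith
          rcases hsurv f hf hy with h | h
          · nlinarith
          · linarith
        · right
          rintro y ⟨⟨hy₁, hy₂⟩, hy⟩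
          have hxy : β * ((1 - y) / β) = 1 - y := mul_div_cancel₀ _ hβ.ne'
          have hx₁ : e ≤ 1 - (1 - y) / β := by
            have : (1 - y) / β ≤ 1 - e := by rw [div_le_iff₀ hβ]; linarith
            linarith
          have hx₂ : 1 - (1 - y) / β ≤ e' := by
            have : 1 - e' ≤ (1 - y) / β := by rw [le_div_iff₀ hβ]; linarith
            linarith
          have hTx : Bmap β (1 - (1 - y) / β) = y := by
            rw [Bmap_of_lt (by linarith)]; linear_combination -hxy
          refine ⟨_, ⟨⟨hx₁, hx₂⟩, mem_survivors_of_Bmap_mem ⟨by linarith, by linarith⟩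
            (fun h => ?_) (by rwa [hTx])⟩, hTx⟩
          linarith [h.2]
      · left
        rw [eq_empty_iff_forall_notMem]
        rintro y ⟨⟨x, ⟨⟨hx₁, hx₂⟩, -⟩, rfl⟩, ⟨hy₁, hy₂⟩, hy⟩
        rw [Bmap_of_lt (by linarith)] at hy₁ hy₂ hy
        have hyf : 1 - β * (1 - x) = f' := by nlinarith
        rw [hyf] at hy
        rcases hsurv f' hf' hy with h | h
        · linarith
        · nlinarith
    · left
      rw [eq_empty_iff_forall_notMem]
      rintro y ⟨⟨x, ⟨⟨hx₁, hx₂⟩, hx⟩, -⟩, -⟩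
      rcases hole x hx with h | h
      · linarith
      · exact hds ((show x = d by linarith) ▸ hx)
  · rcases hgap c hcE with hce | hce
    · left
      rw [eq_empty_iff_forall_notMem]
      rintro y ⟨⟨x, ⟨⟨hx₁, hx₂⟩, hx⟩, -⟩, -⟩
      rcases hole x hx with h | h
      · exact hcs ((show x = c by linarith) ▸ hx)
      · linarith
    · have he2 : e' < 1 / 2 := by linarith
      have hTe := hmap e he (by linarith)
      have hTe' := hmap e' he' he2.ne
      rw [Bmap_of_le (by linarith)] at hTe
      rw [Bmap_of_le he2.le] at hTe'
      rcases hfgap _ hTe with hl | hl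
      · rcases hfgap _ hTe' with hr | hr
        · left
          rw [eq_empty_iff_forall_notMem]
          rintro y ⟨⟨x, ⟨⟨hx₁, hx₂⟩, -⟩, rfl⟩, ⟨hy₁, hy₂⟩, hy⟩
          rw [Bmap_of_le (by linarith)] at hy₁ hy₂ hy
          have hyf : β * x = f := by nlinarith
          rw [hyf] at hy
          rcases hsurv f hf hy with h | h
          · nlinarith
          · linarith
        · right
          rintro y ⟨⟨hy₁, hy₂⟩, hy⟩
          have hxy : β * (y / β) = y := mul_div_cancel₀ _ hβ.ne'
          have hx₁ : e ≤ y / β := by rw [le_div_iff₀ hβ]; linarith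
          have hx₂ : y / β ≤ e' := by rw [div_le_iff₀ hβ]; linarith
          have hTx : Bmap β (y / β) = y := by rw [Bmap_of_le (by linarith), hxy]
          refine ⟨_, ⟨⟨hx₁, hx₂⟩, mem_survivors_of_Bmap_mem ⟨by linarith, by linarith⟩
            (fun h => ?_) (by rwa [hTx])⟩, hTx⟩
          linarith [h.1]
      · left
        rw [eq_empty_iff_forall_notMem]
        rintro y ⟨⟨x, ⟨⟨hx₁, hx₂⟩, -⟩, rfl⟩, ⟨hy₁, hy₂⟩, hy⟩
        rw [Bmap_of_le (by linarith)] at hy₁ hy₂ hy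
        have hyf : β * x = f' := by nlinarith
        rw [hyf] at hy
        rcases hsurv f' hf' hy with h | h
        · linarith
        · nlinarith

end Partition

section Entropy

variable {β c d δ : ℝ} {m : ℕ}

/-- Every subinterval of `[0,1]` of length `δ` is mapped by the `m`-th iterate over some interval
of length `β ^ m * (δ / 4)`, by points that avoid the hole `(c,d)` for the first `m` steps. -/
def HasOntoBranches (β c d δ : ℝ) (m : ℕ) : Prop :=
  ∀ x, 0 ≤ x → x + δ ≤ 1 → ∃ r, 0 ≤ r ∧ r + β ^ m * (δ / 4) ≤ 1 ∧
    ∀ z ∈ Icc r (r + β ^ m * (δ / 4)), ∃ w ∈ Icc x (x + δ), (Bmap β)^[m] w = z ∧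
      ∀ k < m, (Bmap β)^[k] w ∉ Ioo c d

lemma hasOntoBranches_of_scale (h₁ : 1 < β) (h₂ : β ≤ 2) (hδ : 0 < δ)
    (hscale : ∀ x, ∃ u, x ≤ u ∧ u + δ / 2 ≤ x + δ ∧
      ∀ k < m, ∀ z ∈ Ioo u (u + δ / 2), (Bmap β)^[k] z ≠ 1 / 2)
    (hc : 1 / 2 - δ / 8 ≤ c) (hd : d ≤ 1 / 2 + δ / 8) : HasOntoBranches β c d δ m := by
  intro x hx₀ hx₁
  obtain ⟨u, hxu, hux, hu⟩ := hscale x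
  have hβ : 0 < β := by linarith
  have hp : u + δ / 8 ∈ Ioo u (u + δ / 2) := ⟨by linarith, by linarith⟩
  have hq : u + δ / 8 + δ / 4 ∈ Ioo u (u + δ / 2) := ⟨by linarith, by linarith⟩
  have hpow : 0 < β ^ m := by positivity
  refine ⟨(Bmap β)^[m] (u + δ / 8), ?_, ?_, ?_⟩
  · exact (iterate_Bmap_mem h₁ h₂ ⟨by linarith, by linarith⟩ m).1
  · have e := iterate_Bmap_sub hβ hu hp hq
    have := (iterate_Bmap_mem h₁ h₂
      (⟨by linarith, by linarith⟩ : u + δ / 8 + δ / 4 ∈ Icc (0 : ℝ) 1) m).2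
    have e' : β ^ m * (u + δ / 8 + δ / 4 - (u + δ / 8)) = β ^ m * (δ / 4) := by ring
    linarith
  · rintro z ⟨hz₁, hz₂⟩
    set s := (z - (Bmap β)^[m] (u + δ / 8)) / β ^ m with hs
    have hs₀ : 0 ≤ s := div_nonneg (by linarith) hpow.le
    have hs₁ : s ≤ δ / 4 := by rw [hs, div_le_iff₀ hpow]; linarith
    have hsm : β ^ m * s = z - (Bmap β)^[m] (u + δ / 8) := mul_div_cancel₀ _ hpow.ne'
    have hw : u + δ / 8 + s ∈ Ioo u (u + δ / 2) := ⟨by linarith, by linarith⟩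
    refine ⟨u + δ / 8 + s, ⟨by linarith, by linarith⟩, ?_, fun k hk hmem => ?_⟩
    · have e := iterate_Bmap_sub hβ hu hp hw
      linear_combination e + hsm
    · set y := (Bmap β)^[k] (u + δ / 8 + s) with hy
      have hk1 : 1 ≤ β ^ k := one_le_pow₀ h₁.le
      have hk0 : 0 < β ^ k := by positivity
      set t := (1 / 2 - y) / β ^ k with ht
      have htk : β ^ k * t = 1 / 2 - y := mul_div_cancel₀ _ hk0.ne'
      have ht₁ : t < δ / 8 := by
        rw [ht, div_lt_iff₀ hk0]; nlinarith [hmem.1]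
      have ht₂ : -(δ / 8) < t := by
        rw [ht, lt_div_iff₀ hk0]; nlinarith [hmem.2]
      have hv : u + δ / 8 + s + t ∈ Ioo u (u + δ / 2) := ⟨by linarith, by linarith⟩
      have e := iterate_Bmap_sub hβ (fun j hj => hu j (hj.trans hk)) hw hv
      apply hu k hk _ hv
      linear_combination e + htk

lemma exists_mem_survivors (H : HasOntoBranches β c d δ m) (hδ : 0 < δ) (hm : 0 < m)
    (hβm : 4 ≤ β ^ m) (hc : c < 1 / 2) (hd : 1 / 2 < d) {x : ℝ} (hx₀ : 0 ≤ x)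
    (hx₁ : x + δ ≤ 1) : ∃ w ∈ Icc x (x + δ), w ∈ survivors β c d := by
  have key : ∀ n, ∀ x, 0 ≤ x → x + δ ≤ 1 →
      ∃ w ∈ Icc x (x + δ), ∀ k < m * n, (Bmap β)^[k] w ∉ Ioo c d := by
    intro n
    induction n with
    | zero => exact fun x _ _ => ⟨x, ⟨le_rfl, by linarith⟩, by simp⟩
    | succ n ih =>
      intro x hx₀ hx₁
      obtain ⟨r, hr₀, hr₁, hr⟩ := H x hx₀ hx₁
      have hle : δ ≤ β ^ m * (δ / 4) := by nlinarith
      obtain ⟨z, ⟨hz₁, hz₂⟩, hz⟩ := ih r hr₀ (by linarith)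
      obtain ⟨w, hw, hwz, hwk⟩ := hr z ⟨hz₁, by linarith⟩
      refine ⟨w, hw, fun k hk => ?_⟩
      rcases lt_or_ge k m with hkm | hkm
      · exact hwk k hkm
      · obtain ⟨j, rfl⟩ := Nat.exists_eq_add_of_le hkm
        rw [add_comm, Function.iterate_add_apply, hwz]
        exact hz j (by rw [mul_add] at hk; lia)
  have hclosed := isClosed_setOf_iterate_notMem (β := β) hc hd
  obtain ⟨w, hw⟩ := IsCompact.nonempty_iInter_of_sequence_nonempty_isCompact_isClosed
    (fun n => Icc x (x + δ) ∩ {w | ∀ k < n, (Bmap β)^[k] w ∉ Ioo c d})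
    (fun n w hw => ⟨hw.1, fun k hk => hw.2 k (hk.trans n.lt_succ_self)⟩)
    (fun n => by
      obtain ⟨w, hw, hwn⟩ := key n x hx₀ hx₁
      exact ⟨w, hw, fun k hk => hwn k (hk.trans_le (Nat.le_mul_of_pos_left n hm))⟩)
    (isCompact_Icc.inter_right (hclosed 0))
    (fun n => isClosed_Icc.inter (hclosed n))
  rw [mem_iInter] at hw
  have hwI := (hw 0).1
  exact ⟨w, hwI, ⟨hx₀.trans hwI.1, hwI.2.trans hx₁⟩,
    fun n => (hw (n + 1)).2 n n.lt_succ_self⟩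

lemma exists_separated_survivors (H : HasOntoBranches β c d δ m) (hδ : 0 < δ) (hm : 0 < m)
    {K : ℕ} (hK : 1 ≤ K) (hβm : 8 * (K : ℝ) ≤ β ^ m) (hc : c < 1 / 2) (hd : 1 / 2 < d) (n : ℕ)
    {x : ℝ} (hx₀ : 0 ≤ x) (hx₁ : x + δ ≤ 1) :
    ∃ F : Finset ℝ, (∀ y ∈ F, y ∈ Icc x (x + δ) ∧ y ∈ survivors β c d) ∧ F.card = K ^ n ∧
      ∀ y ∈ F, ∀ z ∈ F, y ≠ z → ∃ t ≤ m * n, δ ≤ |(Bmap β)^[t] y - (Bmap β)^[t] z| := by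
  classical
  induction n generalizing x with
  | zero =>
    have hK' : (1 : ℝ) ≤ K := by exact_mod_cast hK
    obtain ⟨w, hw⟩ := exists_mem_survivors H hδ hm (by linarith) hc hd hx₀ hx₁
    exact ⟨{w}, by simpa using hw, by simp, by simp⟩
  | succ n ih =>
    obtain ⟨r, hr₀, hr₁, hr⟩ := H x hx₀ hx₁
    have hlen : 2 * K * δ ≤ β ^ m * (δ / 4) := by nlinarith
    have hi : ∀ i : Fin K, 0 ≤ r + 2 * i * δ ∧ r + 2 * i * δ + δ ≤ r + β ^ m * (δ / 4) := by
      intro i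
      have : (i : ℝ) + 1 ≤ K := by exact_mod_cast i.2
      exact ⟨by positivity, by nlinarith⟩
    choose F hFmem hFcard hFsep using fun i : Fin K => ih (hi i).1 ((hi i).2.trans hr₁)
    choose! g hgI hgT hgk using hr
    have hF : ∀ i, ∀ z ∈ F i, z ∈ Icc r (r + β ^ m * (δ / 4)) := fun i z hz => by
      obtain ⟨⟨hz₁, hz₂⟩, -⟩ := hFmem i z hz
      have : 0 ≤ 2 * (i : ℝ) * δ := by positivity
      exact ⟨by linarith, hz₂.trans (hi i).2⟩
    have far : ∀ i j : Fin K, i < j → ∀ y ∈ F i, ∀ z ∈ F j, δ ≤ z - y := by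
      intro i j hij y hy z hz
      have hij' : (i : ℝ) + 1 ≤ j := by exact_mod_cast hij
      have h₁ := (hFmem i y hy).1.2
      have h₂ := (hFmem j z hz).1.1
      nlinarith
    have hdisj : ((Finset.univ : Finset (Fin K)) : Set (Fin K)).PairwiseDisjoint F := by
      intro i _ j _ hij
      refine Finset.disjoint_left.2 fun y hyi hyj => ?_
      rcases lt_or_gt_of_ne hij with h | h
      · linarith [far i j h y hyi y hyj]
      · linarith [far j i h y hyj y hyi]
    have hG : ∀ z ∈ Finset.univ.biUnion F, ∃ i, z ∈ F i := fun z hz => by simpa using hz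
    have hinj : Set.InjOn g (Finset.univ.biUnion F : Finset ℝ) := by
      intro y hy z hz hyz
      obtain ⟨i, hi⟩ := hG y hy
      obtain ⟨j, hj⟩ := hG z hz
      rw [← hgT y (hF i y hi), ← hgT z (hF j z hj), hyz]
    refine ⟨(Finset.univ.biUnion F).image g, ?_, ?_, ?_⟩
    · simp only [Finset.forall_mem_image]
      intro z hz
      obtain ⟨i, hi⟩ := hG z hz
      have hzr := hF i z hi
      have hgz := hgI z hzr
      exact ⟨hgz, mem_survivors_of_iterate_mem ⟨hx₀.trans hgz.1, hgz.2.trans hx₁⟩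
        (hgk z hzr) (by rw [hgT z hzr]; exact (hFmem i z hi).2)⟩
    · rw [Finset.card_image_of_injOn hinj, Finset.card_biUnion hdisj]
      simp [hFcard, pow_succ, mul_comm]
    · simp only [Finset.forall_mem_image]
      intro y hy z hz hyz
      obtain ⟨i, hyi⟩ := hG y hy
      obtain ⟨j, hzj⟩ := hG z hz
      have hTy := hgT y (hF i y hyi)
      have hTz := hgT z (hF j z hzj)
      have hyz' : y ≠ z := fun h => hyz (by rw [h])
      rcases lt_trichotomy i j with h | rfl | h
      · refine ⟨m, Nat.le_mul_of_pos_right m n.succ_pos, ?_⟩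
        rw [hTy, hTz, abs_sub_comm]
        exact (far i j h y hyi z hzj).trans (le_abs_self _)
      · obtain ⟨t, ht, hsep⟩ := hFsep i y hyi z hzj hyz'
        refine ⟨t + m, by rw [mul_add]; lia, ?_⟩
        rwa [Function.iterate_add_apply, Function.iterate_add_apply, hTy, hTz]
      · refine ⟨m, Nat.le_mul_of_pos_right m n.succ_pos, ?_⟩
        rw [hTy, hTz]
        exact (far j i h z hzj y hyi).trans (le_abs_self _)

/-- Exponentially many separated orbit segments give a lower bound on the entropy. -/
lemma le_coverEntropy_of_separated {T : ℝ → ℝ} {S : Set ℝ} (hδ : 0 < δ) (hm : 0 < m) {K : ℕ}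
    (hK : 1 ≤ K) {h : ℝ} (hh : m * h < Real.log K)
    (hsep : ∀ n, ∃ F : Finset ℝ, (∀ y ∈ F, y ∈ S) ∧ F.card = K ^ n ∧
      ∀ y ∈ F, ∀ z ∈ F, y ≠ z → ∃ t ≤ m * n, δ ≤ |T^[t] y - T^[t] z|) :
    (h : EReal) ≤ Dynamics.coverEntropy T S := by
  set U : SetRel ℝ ℝ := {p | dist p.1 p.2 < δ / 2} with hU
  have hUu : U ∈ uniformity ℝ := Metric.dist_mem_uniformity (by linarith)
  refine le_trans ?_ (Dynamics.netEntropyEntourage_le_coverEntropy _ _ hUu)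
  have hcard : ∀ n, ((K ^ n : ℕ) : ℕ∞) ≤ Dynamics.netMaxcard T S U (m * n + 1) := by
    intro n
    obtain ⟨F, hFS, hFc, hF⟩ := hsep n
    rw [← hFc]
    refine Dynamics.IsDynNetIn.card_le_netMaxcard ⟨hFS, fun y hy z hz hyz => ?_⟩
    refine Set.disjoint_left.2 fun w hwy hwz => ?_
    obtain ⟨t, ht, hd⟩ := hF y hy z hz hyz
    have h₁ : dist (T^[t] y) (T^[t] w) < δ / 2 :=
      Dynamics.mem_ball_dynEntourage.1 hwy t (Nat.lt_succ_of_le ht)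
    have h₂ : dist (T^[t] z) (T^[t] w) < δ / 2 :=
      Dynamics.mem_ball_dynEntourage.1 hwz t (Nat.lt_succ_of_le ht)
    have := dist_triangle_right (T^[t] y) (T^[t] z) (T^[t] w)
    rw [Real.dist_eq] at this
    linarith
  refine Frequently.le_expGrowthSup (frequently_atTop.2 fun N => ?_)
  obtain ⟨j, hj⟩ := exists_nat_gt (h / (Real.log K - m * h))
  set n := max j N
  have hn : h ≤ n * (Real.log K - m * h) := by
    rw [div_lt_iff₀ (by linarith)] at hj
    have : (j : ℝ) ≤ n := by exact_mod_cast le_max_left j N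
    nlinarith
  refine ⟨m * n + 1, ?_, ?_⟩
  · have : N ≤ n := le_max_right j N
    nlinarith
  · have hK0 : (0 : ℝ) < K := by exact_mod_cast hK
    have hexp : Real.exp (h * (m * n + 1 : ℕ)) ≤ ((K ^ n : ℕ) : ℝ) := by
      have : ((K ^ n : ℕ) : ℝ) = Real.exp (n * Real.log K) := by
        rw [Real.exp_nat_mul, Real.exp_log hK0, Nat.cast_pow]
      rw [this, Real.exp_le_exp]
      push_cast
      linarith
    calc EReal.exp ((h : EReal) * (m * n + 1 : ℕ))
        = ENNReal.ofReal (Real.exp (h * (m * n + 1 : ℕ))) := by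
          rw [← EReal.exp_coe]; norm_cast
      _ ≤ ENNReal.ofReal ((K ^ n : ℕ) : ℝ) := ENNReal.ofReal_le_ofReal hexp
      _ = ((K ^ n : ℕ) : ENNReal) := ENNReal.ofReal_natCast _
      _ ≤ _ := by exact_mod_cast ENat.toENNReal_mono (hcard n)

end Entropy

/-- For large `m`, a number `K` of branches with `8 * K ≤ β ^ m` suffices to have entropy close to
`log β`. -/
lemma exists_pow_and_card_branches {β ε : ℝ} (h₁ : 1 < β) (hε : 0 < ε) :
    ∃ m K : ℕ, 0 < m ∧ 1 ≤ K ∧ 8 * (K : ℝ) ≤ β ^ m ∧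
      m * (Real.log β - ε / 2) < Real.log K := by
  obtain ⟨p, hp⟩ := pow_unbounded_of_one_lt 16 h₁
  obtain ⟨q, hq⟩ := exists_nat_gt (Real.log 16 / (ε / 2))
  rw [div_lt_iff₀ (by linarith)] at hq
  set m := max (max p q) 1
  have hpm : 16 ≤ β ^ m := hp.le.trans
    (pow_le_pow_right₀ h₁.le ((le_max_left p q).trans (le_max_left _ _)))
  have hqm : (q : ℝ) ≤ m := by exact_mod_cast (le_max_right p q).trans (le_max_left _ _)
  have hle : (⌊β ^ m / 8⌋₊ : ℝ) ≤ β ^ m / 8 := Nat.floor_le (by linarith)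
  have hlt := Nat.lt_floor_add_one (β ^ m / 8)
  have hge : β ^ m / 16 ≤ (⌊β ^ m / 8⌋₊ : ℝ) := by linarith
  refine ⟨m, ⌊β ^ m / 8⌋₊, lt_of_lt_of_le one_pos (le_max_right _ _), ?_, by linarith, ?_⟩
  · rw [Nat.one_le_floor_iff]
    linarith
  · have := Real.log_le_log (by linarith) hge
    rw [Real.log_div (by linarith) (by norm_num), Real.log_pow] at this
    nlinarith

/-- The orbits of two points that are eventually mapped to `1/2`, together with `0` and `1`, form
a finite set that is forward invariant away from `1/2`. -/
lemma exists_orbit_endpoints {β c d : ℝ} (h₁ : 1 < β) (h₂ : β ≤ 2) (hc : c ∈ Icc (0 : ℝ) 1)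
    (hd : d ∈ Icc (0 : ℝ) 1) {k l : ℕ} (hk : (Bmap β)^[k] c = 1 / 2)
    (hl : (Bmap β)^[l] d = 1 / 2) :
    ∃ E : Finset ℝ, 0 ∈ E ∧ 1 ∈ E ∧ 1 / 2 ∈ E ∧ c ∈ E ∧ d ∈ E ∧
      (∀ e ∈ E, e ∈ Icc (0 : ℝ) 1) ∧ (∀ e ∈ E, e ≠ 1 / 2 → Bmap β e ∈ E) ∧
      ∀ e ∈ E, e = 0 ∨ e = 1 ∨ ∃ n, (Bmap β)^[n] e = 1 / 2 := by
  set E : Finset ℝ := {0, 1} ∪ ((Finset.range (k + 1)).image fun j => (Bmap β)^[j] c) ∪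
    (Finset.range (l + 1)).image fun j => (Bmap β)^[j] d with hEdef
  have hmem : ∀ e, e ∈ E ↔ (e = 0 ∨ e = 1) ∨ (∃ j ≤ k, (Bmap β)^[j] c = e) ∨
      ∃ j ≤ l, (Bmap β)^[j] d = e := fun e => by
    simp [hEdef, or_assoc]
  refine ⟨E, ?_⟩
  simp only [hmem]
  refine ⟨by simp, by simp, Or.inr (Or.inl ⟨k, le_rfl, hk⟩),
    Or.inr (Or.inl ⟨0, k.zero_le, rfl⟩), Or.inr (Or.inr ⟨0, l.zero_le, rfl⟩), ?_, ?_, ?_⟩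
  · rintro e ((rfl | rfl) | ⟨j, -, rfl⟩ | ⟨j, -, rfl⟩)
    · simp
    · simp
    · exact iterate_Bmap_mem h₁ h₂ hc j
    · exact iterate_Bmap_mem h₁ h₂ hd j
  · rintro e ((rfl | rfl) | ⟨j, hj, rfl⟩ | ⟨j, hj, rfl⟩) hne
    · simp [Bmap_zero]
    · simp [Bmap_one]
    · have hjk : j ≠ k := fun h => hne (h ▸ hk)
      exact Or.inr (Or.inl ⟨j + 1, by lia, Function.iterate_succ_apply' _ _ _⟩)
    · have hjl : j ≠ l := fun h => hne (h ▸ hl)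
      exact Or.inr (Or.inr ⟨j + 1, by lia, Function.iterate_succ_apply' _ _ _⟩)
  · rintro e ((h | h) | ⟨j, hj, rfl⟩ | ⟨j, hj, rfl⟩)
    · exact Or.inl h
    · exact Or.inr (Or.inl h)
    · refine Or.inr (Or.inr ⟨k - j, ?_⟩)
      rw [← Function.iterate_add_apply, Nat.sub_add_cancel hj, hk]
    · refine Or.inr (Or.inr ⟨l - j, ?_⟩)
      rw [← Function.iterate_add_apply, Nat.sub_add_cancel hj, hl]

/-- For every `β ∈ (1,2]` and `ε > 0` there is a nonempty compact `B_β`-invariant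
(Markov) subset `𝓑 ⊆ [0,1]` with a finite Markov partition `𝓓` by closed intervals —
each contained in `[0,1/2]` or `[1/2,1]`, with pairwise disjoint interiors, covering `𝓑`,
satisfying the Markov property, containing intervals around `0` and `1` — such that the
topological entropy of `B_β` restricted to `𝓑` exceeds `log β - ε`. -/
theorem exists_markov_subset_large_entropy (β : ℝ) (hβ₁ : 1 < β) (hβ₂ : β ≤ 2)
    (ε : ℝ) (hε : 0 < ε) :
    ∃ (B : Set ℝ) (D : Finset (Set ℝ)),
      B.Nonempty ∧ IsCompact B ∧ B ⊆ Set.Icc (0:ℝ) 1 ∧ Bmap β '' B ⊆ B ∧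
      (∀ I ∈ D, ∃ a b : ℝ, a ≤ b ∧ I = Set.Icc a b) ∧
      (∀ I ∈ D, I ⊆ Set.Icc (0:ℝ) (1/2) ∨ I ⊆ Set.Icc (1/2:ℝ) 1) ∧
      (∀ I ∈ D, ∀ J ∈ D, I ≠ J → interior I ∩ interior J = ∅) ∧
      B ⊆ ⋃ I ∈ D, I ∧
      (∀ I ∈ D, ∀ J ∈ D,
        Bmap β '' (I ∩ B) ∩ (J ∩ B) = ∅ ∨ J ∩ B ⊆ Bmap β '' (I ∩ B)) ∧
      (∃ I ∈ D, (0:ℝ) ∈ I) ∧ (∃ I ∈ D, (1:ℝ) ∈ I) ∧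
      ((Real.log β - ε : ℝ) : EReal) < Dynamics.coverEntropy (Bmap β) B := by
  obtain ⟨m, K, hm, hK, hKβ, hlog⟩ := exists_pow_and_card_branches hβ₁ hε
  obtain ⟨δ, hδ, hδ1, hscale⟩ := exists_scale (by linarith : 0 < β) m
  obtain ⟨c, ⟨hc', hc⟩, k, hk⟩ := exists_iterate_Bmap_eq_half hβ₁ hβ₂
    (by linarith : 0 ≤ 1 / 2 - δ / 8) (by linarith : 1 / 2 - δ / 8 < 1 / 2) (by norm_num)
  obtain ⟨d, ⟨hd, hd'⟩, l, hl⟩ := exists_iterate_Bmap_eq_half hβ₁ hβ₂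
    (by norm_num : (0 : ℝ) ≤ 1 / 2) (by linarith : 1 / 2 < 1 / 2 + δ / 8) (by linarith)
  obtain ⟨E, h0E, h1E, hhalf, hcE, hdE, hE, hmap, hend⟩ := exists_orbit_endpoints hβ₁ hβ₂
    (⟨by linarith, by linarith⟩ : c ∈ Set.Icc (0 : ℝ) 1)
    (⟨by linarith, by linarith⟩ : d ∈ Set.Icc (0 : ℝ) 1) hk hl
  have hsurv : ∀ e ∈ E, e ∈ survivors β c d → e = 0 ∨ e = 1 := by
    intro e he hes
    by_contra! h
    obtain ⟨n, hn⟩ := (hend e he).resolve_left h.1 |>.resolve_left h.2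
    exact hes.2 n (by rw [hn]; exact ⟨hc, hd⟩)
  have hcs : c ∉ survivors β c d := fun h => by rcases hsurv c hcE h with h | h <;> linarith
  have hds : d ∉ survivors β c d := fun h => by rcases hsurv d hdE h with h | h <;> linarith
  have hcover : ∀ x ∈ Set.Icc (0 : ℝ) 1, ∃ I ∈ gapIntervals E, x ∈ I := fun x hx =>
    exists_mem_gapIntervals h0E h1E zero_lt_one hx
  have hbranch := hasOntoBranches_of_scale hβ₁ hβ₂ hδ hscale hc'.le hd'.le
  refine ⟨survivors β c d, gapIntervals E, ⟨0, zero_mem_survivors (by linarith)⟩,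
    isCompact_survivors hc hd, fun x hx => hx.1, (mapsTo_survivors hβ₁ hβ₂).image_subset,
    fun I hI => ?_, fun I hI => ?_,
    fun I hI J hJ h => interior_inter_interior_of_mem_gapIntervals hI hJ h, fun x hx => ?_,
    fun I hI J hJ => gapIntervals_markov hβ₁ hβ₂ hc hd hcE hdE hhalf hE hmap hsurv hcs hds hI hJ,
    hcover 0 (by simp), hcover 1 (by simp), ?_⟩
  · obtain ⟨e, e', h, rfl⟩ := mem_gapIntervals.1 hI
    exact ⟨e, e', h.2.2.1.le, rfl⟩
  · obtain ⟨e, e', ⟨he, he', -, h⟩, rfl⟩ := mem_gapIntervals.1 hI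
    exact (h _ hhalf).symm.imp (fun h => Set.Icc_subset_Icc (hE e he).1 h)
      fun h => Set.Icc_subset_Icc h (hE e' he').2
  · simpa using hcover x hx.1
  · refine lt_of_lt_of_le (EReal.coe_lt_coe_iff.2 (by linarith : _ < Real.log β - ε / 2))
      (le_coverEntropy_of_separated hδ hm hK hlog fun n => ?_)
    obtain ⟨F, hF, hFc, hFs⟩ := exists_separated_survivors hbranch hδ hm hK hKβ hc hd n le_rfl
      (by linarith : 0 + δ ≤ 1)
    exact ⟨F, fun y hy => (hF y hy).2, hFc, hFs⟩
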